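/- For all integers k, n with 1 < k ≤ n ≤ k², all coefficients of the polynomial x ↦ Q(x, k, n, 1/(k−1)) are non-positive; consequently Q(x, k, n, 1/(k−1)) ≤ 0 for every real x > 0. -/

import Mathlib

/-- The coefficients of the sextic polynomial `Q(·,k,n,α)` from the paper:
`Qcoef k n α i` is the coefficient of `x ^ i`. -/
noncomputable def Qcoef (k n α : ℝ) : Fin 7 → ℝ :=
  ![(α * k + 1) * (k - n) ^ 3,
    (n - k) ^ 2 * (-α * k * (4 * k - n - 6) - 2 * k - n),
    (k - n) * (α ^ 2 * k ^ 2 * (k - 2 * n + 3)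
      + α * k * (6 * k ^ 2 - k * (3 * n + 22) + 12 * n + 3) + 3 * k * (n + 1) - 4 * n),
    α ^ 2 * k ^ 2 * (-4 * k ^ 2 + k * (9 * n - 10) - 4 * n ^ 2 + 7 * n + 2)
      + α * k * (-4 * k ^ 3 + k ^ 2 * (3 * n + 32) - 2 * k * (19 * n + 4)
          + 5 * n * (2 * n + 1))
      + 2 * k ^ 3 - k ^ 2 * (3 * n + 10) + 17 * k * n - 6 * n ^ 2,
    α ^ 2 * k ^ 2 * (6 * k ^ 2 + 3 * k * (4 - 3 * n) + 2 * n ^ 2 - 5 * n - 6)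
      + α * k * (k ^ 3 - 24 * k ^ 2 + 2 * k * (11 * n + 3) - n * (4 * n + 1))
      - k ^ 3 + 12 * k ^ 2 - 13 * k * n + 2 * n ^ 2,
    k * (α ^ 2 * k * (-4 * k ^ 2 + 3 * k * (n - 2) + n + 6)
      + α * (10 * k ^ 2 - 6 * k * n - n) + 3 * n - 6 * k),
    k ^ 2 * (α * (k - 1) - 1) * (α * (k + 2) - 1)]

/-- The sextic polynomial `Q(x,k,n,α)` from the paper, written in terms of its
coefficients. -/
noncomputable def Q (x k n α : ℝ) : ℝ :=
  ∑ i : Fin 7, Qcoef k n α i * x ^ (i : ℕ)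

/-- At `k = m + 1`, `n = m + 1 + t` and `α = 1 / m`, all coefficients of `Q` are non-positive
as soon as `1 ≤ m` and `0 ≤ t ≤ m (m + 1)`. -/
theorem Qcoef_add_one_nonpos {m t : ℝ} (hm : 1 ≤ m) (ht : 0 ≤ t) (htm : t ≤ m * (m + 1))
    (i : Fin 7) : Qcoef (m + 1) (m + 1 + t) (1 / m) i ≤ 0 := by
  have hm0 : 0 < m := by linarith
  have hmne : m ≠ 0 := hm0.ne'
  have hs : 0 ≤ m ^ 2 - 1 := by nlinarith
  have hd : 0 ≤ m * (m + 1) - t := by linarith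
  have nonpos_of_eq_neg_div {c p : ℝ} (d : ℕ) (h : c = -(p / m ^ d)) (hp : 0 ≤ p) : c ≤ 0 := by
    rw [h, neg_nonpos]
    positivity
  fin_cases i <;> simp only [Qcoef]
  · refine nonpos_of_eq_neg_div (p := (2 * m + 1) * t ^ 3) 1 ?_ (by positivity)
    simp
    field_simp
    ring
  · refine nonpos_of_eq_neg_div
      (p := t ^ 2 * (5 * m ^ 2 + 2 * m - 3 + (m * (m + 1) - t))) 1 ?_ ?_
    · simp
      field_simp
      ring
    · have h2 : 0 ≤ 5 * m ^ 2 + 2 * m - 3 := by linarith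
      positivity
  · refine nonpos_of_eq_neg_div
      (p := t * (6 * m ^ 2 * (m ^ 2 - 1) + 3 * m * (m ^ 2 - 1) + 2 * m + 2
        + t * (3 * (m ^ 2 - 1) + 5 * m + 1))) 2 ?_ (by positivity)
    simp
    field_simp
    ring
  · refine nonpos_of_eq_neg_div
      (p := (m ^ 2 - 1) * m * (2 * m - 1) * (m + 1) + t * ((m ^ 2 - 1) * (7 * m + 8)
        + 2 * m * (m * (m + 1) - t) + 4 * t)) 2 ?_ ?_
    · simp
      field_simp
      ring
    · have h2 : 0 ≤ 2 * m - 1 := by linarith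
      positivity
  · refine nonpos_of_eq_neg_div
      (p := 5 * (m ^ 2 - 1) * m * (m + 1)
        + t * (10 * (m + 1) + 2 * (m * (m + 1) - t))) 2 ?_ (by positivity)
    simp
    field_simp
    ring
  · refine nonpos_of_eq_neg_div (p := 4 * (m + 1) * (m * (m + 1) - t)) 2 ?_ (by positivity)
    simp
    field_simp
    ring
  · refine nonpos_of_eq_neg_div (p := 0) 0 ?_ le_rfl
    simp [hmne]

theorem Qcoef_nonpos_and_Q_nonpos (k n : ℕ) (hk : 1 < k) (hkn : k ≤ n)
    (hnk : n ≤ k ^ 2) :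
    (∀ i : Fin 7, Qcoef k n (1 / ((k : ℝ) - 1)) i ≤ 0) ∧
    ∀ x : ℝ, 0 < x → Q x k n (1 / ((k : ℝ) - 1)) ≤ 0 := by
  have hk' : (2 : ℝ) ≤ k := by exact_mod_cast hk
  have hkn' : (k : ℝ) ≤ n := by exact_mod_cast hkn
  have hnk' : (n : ℝ) ≤ (k : ℝ) ^ 2 := by exact_mod_cast hnk
  have hcoef (i : Fin 7) : Qcoef k n (1 / ((k : ℝ) - 1)) i ≤ 0 := by
    have h := Qcoef_add_one_nonpos (m := (k : ℝ) - 1) (t := (n : ℝ) - k)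
      (by linarith) (by linarith) (by linarith) i
    rwa [sub_add_cancel, add_sub_cancel] at h
  exact ⟨hcoef, fun x hx => Finset.sum_nonpos fun i _ =>
    mul_nonpos_of_nonpos_of_nonneg (hcoef i) (by positivity)⟩
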